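/- Let k be a field of characteristic 0, R = k[X_1,...,X_r] acting on D = k[x_1,...,x_r] by differentiation. For any nonzero vector subspace W ⊆ D_j, the quotient A_W := R/Ann_R(W) is an Artinian level graded algebra of socle degree j, and [Ann_R(W)]_j = W^⊥ under the perfect pairing R_j × D_j → k. -/

import Mathlib

/-- The iterated partial derivative operator `∂^E` associated to a
multi-index `E`. -/
noncomputable def pdPow {k : Type*} [CommSemiring k] {r : ℕ} (E : Fin r →₀ ℕ) :
    MvPolynomial (Fin r) k →ₗ[k] MvPolynomial (Fin r) k :=
  ((List.finRange r).map fun i =>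
    ((MvPolynomial.pderiv i :
        Derivation k (MvPolynomial (Fin r) k) (MvPolynomial (Fin r) k)).toLinearMap) ^ (E i)).prod

/-- The action `F * f` of a polynomial `F` on a polynomial `f` by letting each
variable `X i` of `F` act as `∂/∂x i`. -/
noncomputable def act {k : Type*} [CommSemiring k] {r : ℕ}
    (F f : MvPolynomial (Fin r) k) : MvPolynomial (Fin r) k :=
  ∑ E ∈ F.support, F.coeff E • (pdPow E) f

open MvPolynomial in
noncomputable def phiA {k : Type*} [Field k] {r : ℕ} (m : Fin r →₀ ℕ) :
    MvPolynomial (Fin r) k →ₗ[k] k :=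
  (((∏ i, (m i).factorial : ℕ) : k)) • lcoeff k m

theorem phiA_apply {k : Type*} [Field k] {r : ℕ} (m : Fin r →₀ ℕ)
    (f : MvPolynomial (Fin r) k) :
    phiA m f = ((∏ i, (m i).factorial : ℕ) : k) * f.coeff m := rfl

theorem phiA_ne {k : Type*} [Field k] [CharZero k] {r : ℕ} (m : Fin r →₀ ℕ) :
    ((∏ i, (m i).factorial : ℕ) : k) ≠ 0 := by
  rw [Nat.cast_ne_zero, Finset.prod_ne_zero_iff]
  intro i _
  exact Nat.factorial_ne_zero _

theorem phiA_ext {k : Type*} [Field k] [CharZero k] {r : ℕ}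
    {f : MvPolynomial (Fin r) k} (h : ∀ m, phiA m f = 0) : f = 0 := by
  ext m
  have := h m
  rw [phiA_apply] at this
  simpa using (mul_eq_zero.mp this).resolve_left (phiA_ne m)

theorem phiA_hom {k : Type*} [Field k] {r j : ℕ}
    {f : MvPolynomial (Fin r) k} (hf : f.IsHomogeneous j) {m : Fin r →₀ ℕ}
    (hm : m.degree ≠ j) : phiA m f = 0 := by
  rw [phiA_apply, hf.coeff_eq_zero hm, mul_zero]

theorem phiA_pderiv {k : Type*} [Field k] {r : ℕ} (m : Fin r →₀ ℕ) (i : Fin r)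
    (f : MvPolynomial (Fin r) k) :
    phiA m (MvPolynomial.pderiv i f) = phiA (m + Finsupp.single i 1) f := by
  have hp : (∏ l, ((m + Finsupp.single i 1 : Fin r →₀ ℕ) l).factorial)
      = (m i + 1) * ∏ l, (m l).factorial := by
    rw [← Finset.mul_prod_erase _ _ (Finset.mem_univ i),
      ← Finset.mul_prod_erase _ (fun l => (m l).factorial) (Finset.mem_univ i)]
    have : ∏ x ∈ Finset.univ.erase i, ((m + Finsupp.single i 1 : Fin r →₀ ℕ) x).factorial
        = ∏ x ∈ Finset.univ.erase i, (m x).factorial := by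
      apply Finset.prod_congr rfl
      intro x hx
      rw [Finsupp.add_apply, Finsupp.single_eq_of_ne (Finset.ne_of_mem_erase hx), add_zero]
    rw [this]
    simp [Nat.factorial_succ, mul_assoc]
  rw [phiA_apply, phiA_apply, hp, MvPolynomial.coeff_pderiv]
  push_cast
  ring

theorem phiA_pow {k : Type*} [Field k] {r : ℕ} (i : Fin r) (n : ℕ) :
    ∀ (m : Fin r →₀ ℕ) (f : MvPolynomial (Fin r) k),
    phiA m ((((MvPolynomial.pderiv i :
        Derivation k (MvPolynomial (Fin r) k) (MvPolynomial (Fin r) k)).toLinearMap) ^ n) f)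
      = phiA (m + Finsupp.single i n) f := by
  induction n with
  | zero => intro m f; simp
  | succ n ih =>
    intro m f
    rw [pow_succ, Module.End.mul_apply, ih]
    erw [phiA_pderiv]
    rw [add_assoc, ← Finsupp.single_add]

theorem phiA_list {k : Type*} [Field k] {r : ℕ} (E : Fin r →₀ ℕ) (l : List (Fin r)) :
    ∀ (m : Fin r →₀ ℕ) (f : MvPolynomial (Fin r) k),
    phiA m ((l.map fun i => ((MvPolynomial.pderiv i :
        Derivation k (MvPolynomial (Fin r) k) (MvPolynomial (Fin r) k)).toLinearMap) ^ (E i)).prod f)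
      = phiA (m + (l.map fun i => Finsupp.single i (E i)).sum) f := by
  induction l with
  | nil => intro m f; simp
  | cons a l ih =>
    intro m f
    rw [List.map_cons, List.prod_cons, Module.End.mul_apply, phiA_pow, ih, List.map_cons,
      List.sum_cons, add_assoc]

theorem phiA_pdPow {k : Type*} [Field k] {r : ℕ} (E m : Fin r →₀ ℕ)
    (f : MvPolynomial (Fin r) k) : phiA m (pdPow E f) = phiA (m + E) f := by
  rw [pdPow, phiA_list]
  congr 2
  rw [← List.ofFn_eq_map, List.sum_ofFn]
  rw [Finsupp.univ_sum_single E]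

theorem phiA_act {k : Type*} [Field k] {r : ℕ} (m : Fin r →₀ ℕ)
    (F f : MvPolynomial (Fin r) k) :
    phiA m (act F f) = ∑ E ∈ F.support, F.coeff E * phiA (m + E) f := by
  simp [act, map_sum, phiA_pdPow]

noncomputable def actL {k : Type*} [Field k] {r : ℕ} (m : Fin r →₀ ℕ)
    (f : MvPolynomial (Fin r) k) : MvPolynomial (Fin r) k →ₗ[k] k :=
  (MvPolynomial.basisMonomials (Fin r) k).constr k (fun E => phiA (m + E) f)

theorem actL_monomial {k : Type*} [Field k] {r : ℕ} (m E : Fin r →₀ ℕ) (c : k)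
    (f : MvPolynomial (Fin r) k) :
    actL m f (MvPolynomial.monomial E c) = c * phiA (m + E) f := by
  have h : MvPolynomial.monomial E c = c • MvPolynomial.basisMonomials (Fin r) k E := by
    simp [MvPolynomial.smul_monomial]
  rw [h, map_smul, actL, Module.Basis.constr_basis, smul_eq_mul]

theorem phiA_actL {k : Type*} [Field k] {r : ℕ} (m : Fin r →₀ ℕ)
    (F f : MvPolynomial (Fin r) k) : phiA m (act F f) = actL m f F := by
  rw [phiA_act]
  conv_rhs => rw [F.as_sum, map_sum]
  exact Finset.sum_congr rfl fun E _ => (actL_monomial m E _ f).symm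

theorem phiA_act_mul {k : Type*} [Field k] {r : ℕ} (m : Fin r →₀ ℕ)
    (H F f : MvPolynomial (Fin r) k) :
    phiA m (act (H * F) f) = ∑ E ∈ H.support, H.coeff E * phiA (m + E) (act F f) := by
  rw [phiA_actL]
  conv_lhs => rw [H.as_sum, Finset.sum_mul, map_sum]
  refine Finset.sum_congr rfl fun E _ => ?_
  rw [phiA_act]
  conv_lhs => rw [F.as_sum, Finset.mul_sum, map_sum]
  rw [Finset.mul_sum]
  refine Finset.sum_congr rfl fun E' _ => ?_
  rw [MvPolynomial.monomial_mul, actL_monomial, add_assoc, mul_assoc]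

/-- For a nonzero subspace `W ⊆ D_j`, the annihilator
`Iset = Ann_R(W) = {F | F * W = 0}` is a homogeneous ideal, the quotient
`A_W = R/Ann_R(W)` is an Artinian level graded algebra of socle degree `j`,
and the degree-`j` component of `Ann_R(W)` is `W^⊥`. -/
theorem statement_13 {k : Type*} [Field k] [CharZero k] (r j : ℕ)
    (W : Submodule k (MvPolynomial (Fin r) k)) (hW : W ≠ ⊥)
    (hWhom : ∀ f ∈ W, MvPolynomial.IsHomogeneous f j)
    (Iset : Set (MvPolynomial (Fin r) k))
    (hIset : Iset = {F : MvPolynomial (Fin r) k | ∀ w ∈ W, act F w = 0}) :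
    -- `Iset` is an ideal
    (∀ F G : MvPolynomial (Fin r) k, F ∈ Iset → G ∈ Iset → F + G ∈ Iset) ∧
    (∀ (c : k) (F : MvPolynomial (Fin r) k), F ∈ Iset → c • F ∈ Iset) ∧
    (∀ H F : MvPolynomial (Fin r) k, F ∈ Iset → H * F ∈ Iset) ∧
    -- `Iset` is homogeneous
    (∀ F ∈ Iset, ∀ d : ℕ, MvPolynomial.homogeneousComponent d F ∈ Iset) ∧
    -- the quotient is Artinian: everything of degree `> j` lies in `Iset`
    (∀ d : ℕ, j < d → ∀ F : MvPolynomial (Fin r) k, F.IsHomogeneous d → F ∈ Iset) ∧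
    -- socle degree `j`: the degree-`j` component of the quotient is nonzero
    (∃ F : MvPolynomial (Fin r) k, F.IsHomogeneous j ∧ F ∉ Iset) ∧
    -- the quotient is level: the socle is concentrated in degree `j`
    (∀ d < j, ∀ F : MvPolynomial (Fin r) k, F.IsHomogeneous d → F ∉ Iset →
      ∃ G : MvPolynomial (Fin r) k, G.IsHomogeneous 1 ∧ G * F ∉ Iset) ∧
    -- the degree-`j` component of `Iset` is `W^⊥`
    (∀ F : MvPolynomial (Fin r) k, F.IsHomogeneous j →
      (F ∈ Iset ↔ ∀ w ∈ W, act F w = 0)) := by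
  subst hIset
  have key : ∀ F : MvPolynomial (Fin r) k,
      F ∈ {F : MvPolynomial (Fin r) k | ∀ w ∈ W, act F w = 0} ↔
        ∀ w ∈ W, ∀ m, phiA m (act F w) = 0 := by
    intro F
    refine ⟨fun h w hw m => by rw [h w hw, map_zero], fun h w hw => phiA_ext (h w hw)⟩
  simp only [key]
  refine ⟨?_, ?_, ?_, ?_, ?_, ?_, ?_, ?_⟩
  · intro F G hF hG w hw m
    have h1 := hF w hw m
    have h2 := hG w hw m
    rw [phiA_actL] at *
    rw [map_add, h1, h2, add_zero]
  · intro c F hF w hw m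
    have h1 := hF w hw m
    rw [phiA_actL] at *
    rw [map_smul, h1, smul_zero]
  · intro H F hF w hw m
    rw [phiA_act_mul]
    exact Finset.sum_eq_zero fun E _ => by rw [hF w hw, mul_zero]
  · intro F hF d w hw m
    have h1 := hF w hw m
    rw [phiA_act] at h1
    have hs : (MvPolynomial.homogeneousComponent d F).support ⊆ F.support := by
      intro E hE
      rw [MvPolynomial.mem_support_iff, MvPolynomial.coeff_homogeneousComponent] at hE
      rw [MvPolynomial.mem_support_iff]
      intro h0
      exact hE (by simp [h0])
    rw [phiA_act, Finset.sum_subset hs (fun E _ hE => by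
      rw [MvPolynomial.notMem_support_iff.mp hE, zero_mul])]
    by_cases hd : m.degree + d = j
    · rw [← h1]
      refine Finset.sum_congr rfl fun E _ => ?_
      rw [MvPolynomial.coeff_homogeneousComponent]
      split_ifs with h
      · rfl
      · rw [phiA_hom (hWhom w hw), mul_zero, mul_zero]
        rw [map_add]; omega
    · refine Finset.sum_eq_zero fun E _ => ?_
      rw [MvPolynomial.coeff_homogeneousComponent]
      split_ifs with h
      · rw [phiA_hom (hWhom w hw), mul_zero]
        rw [map_add]; omega
      · rw [zero_mul]
  · intro d hd F hF w hw m
    rw [phiA_act]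
    refine Finset.sum_eq_zero fun E _ => ?_
    by_cases h : E.degree = d
    · rw [phiA_hom (hWhom w hw), mul_zero]
      rw [map_add]; omega
    · rw [hF.coeff_eq_zero h, zero_mul]
  · obtain ⟨w, hw, hw0⟩ := W.exists_mem_ne_zero_of_ne_bot hW
    obtain ⟨m, hm⟩ : ∃ m, phiA m w ≠ 0 := by
      by_contra! h
      exact hw0 (phiA_ext h)
    have hd : m.degree = j := by
      by_contra h
      exact hm (phiA_hom (hWhom w hw) h)
    refine ⟨MvPolynomial.monomial m 1, MvPolynomial.isHomogeneous_monomial _ hd, fun h => ?_⟩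
    have := h w hw 0
    rw [phiA_actL, actL_monomial, zero_add, one_mul] at this
    exact hm this
  · intro d hd F hF hn
    push Not at hn
    obtain ⟨w, hw, m, hm⟩ := hn
    have hm0 : m ≠ 0 := by
      rintro rfl
      apply hm
      rw [phiA_act]
      refine Finset.sum_eq_zero fun E _ => ?_
      by_cases h : E.degree = d
      · rw [phiA_hom (hWhom w hw), mul_zero]
        rw [zero_add]; omega
      · rw [hF.coeff_eq_zero h, zero_mul]
    obtain ⟨i, hi⟩ := Finsupp.ne_iff.mp hm0
    refine ⟨MvPolynomial.X i, MvPolynomial.isHomogeneous_X _ _, fun h => hm ?_⟩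
    have h1 := h w hw (m - Finsupp.single i 1)
    have hle : Finsupp.single i 1 ≤ m := by
      rw [Finsupp.single_le_iff]
      exact Nat.one_le_iff_ne_zero.mpr hi
    rw [phiA_act_mul, MvPolynomial.support_X, Finset.sum_singleton, MvPolynomial.coeff_X, if_pos rfl,
      one_mul, tsub_add_cancel_of_le hle] at h1
    exact h1
  · intro F _
    exact ⟨fun h w hw => phiA_ext (h w hw), fun h w hw m => by rw [h w hw, map_zero]⟩
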